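/- Let k be any field and consider the polynomial ring k[x,y,u,v,f,g,p,q] graded so that x, y, u, v have degree 1 and f, g, p, q have degree 2. Then the weighted-homogeneous degree-4 polynomial x²f + y²g + u²p + v²q has strength exactly 4: it admits a strength decomposition of length 4 but admits no strength decomposition of length 3. -/

import Mathlib

/-- The weights on the polynomial ring `k[x,y,u,v,f,g,p,q]`: the first four variables
`x, y, u, v` have degree 1 and the last four variables `f, g, p, q` have degree 2. -/
def strengthWeight : Fin 8 → ℕ := fun i => if (i : ℕ) < 4 then 1 else 2

/-- `F` admits a strength decomposition of length `r` in the weighted polynomial ring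
`k[x,y,u,v,f,g,p,q]`: an expression `F = ∑ i, g i * h i` where each `g i`, `h i` is
weighted-homogeneous of some degree between `1` and `d - 1`. -/
def WHasStrengthDecompOfLength {k : Type*} [CommSemiring k]
    (d r : ℕ) (F : MvPolynomial (Fin 8) k) : Prop :=
  ∃ (g h : Fin r → MvPolynomial (Fin 8) k) (a b : Fin r → ℕ),
    (∀ i, 1 ≤ a i ∧ a i ≤ d - 1 ∧ (g i).IsWeightedHomogeneous strengthWeight (a i)) ∧
    (∀ i, 1 ≤ b i ∧ b i ≤ d - 1 ∧ (h i).IsWeightedHomogeneous strengthWeight (b i)) ∧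
    F = ∑ i, g i * h i

/-- A subspace `V` and a subspace `K` orthogonal to the squares of all vectors of `V` have
dimensions adding up to at most the dimension of the ambient space. -/
lemma finrank_add_finrank_le_of_sum_sq_mul_eq_zero {k ι : Type*} [Field k] [Fintype ι]
    (V K : Submodule k (ι → k)) (h : ∀ x ∈ V, ∀ z ∈ K, ∑ i, x i ^ 2 * z i = 0) :
    Module.finrank k V + Module.finrank k K ≤ Fintype.card ι := by
  classical
  let v : ι → Module.Dual k V := fun i => LinearMap.proj i ∘ₗ V.subtype
  obtain ⟨κ, a, ha, hsp, hli⟩ := exists_linearIndependent' k v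
  have : Fintype κ := Fintype.ofInjective a ha
  let r : V →ₗ[k] (κ → k) := LinearMap.pi fun j => v (a j)
  have hr : Function.Injective r := by
    rw [← LinearMap.ker_eq_bot, LinearMap.ker_eq_bot']
    intro x hx
    have hle : Submodule.span k (Set.range v) ≤ LinearMap.ker (Module.Dual.eval k V x) := by
      rw [← hsp, Submodule.span_le]
      rintro _ ⟨j, rfl⟩
      exact congrFun hx j
    ext i
    exact hle (Submodule.subset_span ⟨i, rfl⟩)
  have hcard : Fintype.card κ ≤ Module.finrank k V := by
    simpa using hli.fintype_card_le_finrank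
  have hdim : Module.finrank k V = Module.finrank k (κ → k) :=
    le_antisymm (LinearMap.finrank_le_finrank_of_injective hr) (by simpa using hcard)
  have hsurj : Function.Surjective r :=
    (LinearMap.injective_iff_surjective_of_finrank_eq_finrank hdim).1 hr
  let s : K →ₗ[k] ({i // i ∉ Set.range a} → k) :=
    LinearMap.pi fun i => LinearMap.proj i.1 ∘ₗ K.subtype
  have hs : Function.Injective s := by
    rw [← LinearMap.ker_eq_bot, LinearMap.ker_eq_bot']
    intro z hz
    have hout : ∀ i, i ∉ Set.range a → (z : ι → k) i = 0 := fun i hi => congrFun hz ⟨i, hi⟩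
    ext i
    by_cases hi : i ∈ Set.range a
    · obtain ⟨j, rfl⟩ := hi
      obtain ⟨x, hx⟩ := hsurj (Pi.single j 1)
      have hx' : ∀ j', (x : ι → k) (a j') = (Pi.single j 1 : κ → k) j' := congrFun hx
      have hxz := h x x.2 z z.2
      rw [Finset.sum_eq_single (a j)] at hxz
      · simpa [hx'] using hxz
      · intro i _ hij
        by_cases hi : i ∈ Set.range a
        · obtain ⟨j', rfl⟩ := hi
          have : j' ≠ j := fun e => hij (e ▸ rfl)
          simp [hx', this]
        · simp [hout i hi]
      · simp
    · exact hout i hi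
  have h1 := LinearMap.finrank_le_finrank_of_injective hs
  have h2 : Fintype.card {i // i ∉ Set.range a} = Fintype.card ι - Fintype.card κ := by
    rw [Fintype.card_subtype_compl]
    congr 1
    exact (Fintype.card_congr (Equiv.ofInjective a ha)).symm
  have h3 := Fintype.card_le_of_injective a ha
  simp only [Module.finrank_fintype_fun_eq_card] at h1 hdim
  omega

/-- A linear map whose image is totally singular for the hyperbolic quadratic form has a large
kernel. -/
lemma finrank_le_card_add_finrank_ker {k ι Z : Type*} [Field k] [Fintype ι] [AddCommGroup Z]
    [Module k Z] [FiniteDimensional k Z] (T : Z →ₗ[k] (ι → k) × (ι → k))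
    (h : ∀ z, ∑ i, (T z).1 i * (T z).2 i = 0) :
    Module.finrank k Z ≤ Fintype.card ι + Module.finrank k (LinearMap.ker T) := by
  classical
  let B : LinearMap.BilinForm k ((ι → k) × (ι → k)) :=
    LinearMap.mk₂ k (fun p q => ∑ i, (p.1 i * q.2 i + p.2 i * q.1 i))
      (by intros; simp only [← Finset.sum_add_distrib]; congr! 1; simp; ring)
      (by intros; simp only [Finset.smul_sum]; congr! 1; simp; ring)
      (by intros; simp only [← Finset.sum_add_distrib]; congr! 1; simp; ring)
      (by intros; simp only [Finset.smul_sum]; congr! 1; simp; ring)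
  have hB : ∀ p q, B p q = ∑ i, (p.1 i * q.2 i + p.2 i * q.1 i) := fun _ _ => rfl
  have hker : B.ker = ⊥ := by
    rw [LinearMap.ker_eq_bot']
    intro p hp
    have hp' : ∀ q, B p q = 0 := fun q => by rw [hp]; rfl
    ext i
    · simpa [hB, Pi.single_apply] using hp' (0, Pi.single i 1)
    · simpa [hB, Pi.single_apply] using hp' (Pi.single i 1, 0)
  have hle : LinearMap.range T ≤ B.orthogonal (LinearMap.range T) := by
    rintro _ ⟨z, rfl⟩
    rw [LinearMap.BilinForm.mem_orthogonal_iff]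
    rintro _ ⟨z', rfl⟩
    have hadd := h (z' + z)
    simp only [map_add, Prod.fst_add, Prod.snd_add, Pi.add_apply, add_mul, mul_add,
      Finset.sum_add_distrib, h, zero_add, add_zero] at hadd
    rw [hB, Finset.sum_add_distrib, ← hadd]
    simp only [mul_comm, add_comm]
  have h1 := Submodule.finrank_mono hle
  have h2 := LinearMap.BilinForm.finrank_add_finrank_orthogonal' (B := B) (LinearMap.range T)
  have h3 := LinearMap.finrank_range_add_finrank_ker T
  rw [hker, inf_bot_eq, finrank_bot, Module.finrank_prod, Module.finrank_fintype_fun_eq_card] at h2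
  omega

/-- The point of affine 8-space with the given degree 1 and degree 2 coordinates. -/
def weightedPoint {k : Type*} (x z : Fin 4 → k) : Fin 8 → k :=
  ![x 0, x 1, x 2, x 3, z 0, z 1, z 2, z 3]

lemma weightedPoint_zero {k : Type*} [Zero k] : weightedPoint (0 : Fin 4 → k) 0 = 0 := by
  ext i; fin_cases i <;> rfl

section

open MvPolynomial

lemma weight_strengthWeight (d : Fin 8 →₀ ℕ) : Finsupp.weight strengthWeight d =
    d 0 + d 1 + d 2 + d 3 + 2 * (d 4 + d 5 + d 6 + d 7) := by
  rw [Finsupp.weight_apply, Finsupp.sum_fintype _ _ (by simp), Fin.sum_univ_eight]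
  simp [strengthWeight]
  ring

lemma eval_weightedPoint_monomial {k : Type*} [CommSemiring k] (d : Fin 8 →₀ ℕ) (c : k)
    (x z : Fin 4 → k) : eval (weightedPoint x z) (monomial d c) =
      c * (x 0 ^ d 0 * x 1 ^ d 1 * x 2 ^ d 2 * x 3 ^ d 3 *
        z 0 ^ d 4 * z 1 ^ d 5 * z 2 ^ d 6 * z 3 ^ d 7) := by
  rw [eval_monomial, Finsupp.prod_fintype _ _ (by simp), Fin.prod_univ_eight]
  rfl

lemma MvPolynomial.IsWeightedHomogeneous.induction_monomial {σ R M : Type*} [CommSemiring R]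
    [AddCommMonoid M] {w : σ → M} {n : M} {φ : MvPolynomial σ R}
    (hφ : φ.IsWeightedHomogeneous w n) {p : MvPolynomial σ R → Prop} (zero : p 0)
    (add : ∀ f g, p f → p g → p (f + g))
    (mon : ∀ d c, Finsupp.weight w d = n → p (monomial d c)) : p φ := by
  rw [φ.as_sum]
  exact Finset.sum_induction _ p add zero fun d hd => mon _ _ (hφ (mem_support_iff.1 hd))

lemma eval_weightedPoint_of_degree_one {k : Type*} [CommSemiring k] {φ : MvPolynomial (Fin 8) k}
    (hφ : φ.IsWeightedHomogeneous strengthWeight 1) :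
    ∃ l : (Fin 4 → k) →ₗ[k] k, ∀ x z, eval (weightedPoint x z) φ = l x := by
  refine hφ.induction_monomial (p := fun φ => ∃ l : (Fin 4 → k) →ₗ[k] k,
    ∀ x z, eval (weightedPoint x z) φ = l x) ⟨0, by simp⟩ ?_ ?_
  · rintro f g ⟨l, hl⟩ ⟨m, hm⟩
    exact ⟨l + m, by simp [hl, hm]⟩
  · intro d c hd
    rw [weight_strengthWeight] at hd
    refine ⟨c • ∑ i : Fin 4, d (i.castLE (by norm_num)) • LinearMap.proj i, fun x z => ?_⟩
    rw [eval_weightedPoint_monomial]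
    have h4 : d 4 = 0 := by omega
    have h5 : d 5 = 0 := by omega
    have h6 : d 6 = 0 := by omega
    have h7 : d 7 = 0 := by omega
    have h : (d 0 = 1 ∧ d 1 = 0 ∧ d 2 = 0 ∧ d 3 = 0) ∨ (d 0 = 0 ∧ d 1 = 1 ∧ d 2 = 0 ∧ d 3 = 0) ∨
      (d 0 = 0 ∧ d 1 = 0 ∧ d 2 = 1 ∧ d 3 = 0) ∨ (d 0 = 0 ∧ d 1 = 0 ∧ d 2 = 0 ∧ d 3 = 1) := by
      omega
    rcases h with h | h | h | h <;> simp [Fin.sum_univ_four, h, h4, h5, h6, h7]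

lemma eval_weightedPoint_of_degree_two {k : Type*} [CommSemiring k] {φ : MvPolynomial (Fin 8) k}
    (hφ : φ.IsWeightedHomogeneous strengthWeight 2) :
    ∃ A : (Fin 4 → k) →ₗ[k] k, ∀ x z,
      eval (weightedPoint x z) φ = A z + eval (weightedPoint x 0) φ := by
  refine hφ.induction_monomial (p := fun φ => ∃ A : (Fin 4 → k) →ₗ[k] k, ∀ x z,
    eval (weightedPoint x z) φ = A z + eval (weightedPoint x 0) φ) ⟨0, by simp⟩ ?_ ?_
  · rintro f g ⟨l, hl⟩ ⟨m, hm⟩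
    refine ⟨l + m, fun x z => ?_⟩
    rw [map_add, hl, hm, map_add, LinearMap.add_apply]
    ring
  · intro d c hd
    rw [weight_strengthWeight] at hd
    refine ⟨c • ∑ i : Fin 4, d (i.natAdd 4) • LinearMap.proj i, fun x z => ?_⟩
    rw [eval_weightedPoint_monomial, eval_weightedPoint_monomial]
    have h : (d 4 = 0 ∧ d 5 = 0 ∧ d 6 = 0 ∧ d 7 = 0) ∨
      (d 0 = 0 ∧ d 1 = 0 ∧ d 2 = 0 ∧ d 3 = 0 ∧
      ((d 4 = 1 ∧ d 5 = 0 ∧ d 6 = 0 ∧ d 7 = 0) ∨ (d 4 = 0 ∧ d 5 = 1 ∧ d 6 = 0 ∧ d 7 = 0) ∨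
      (d 4 = 0 ∧ d 5 = 0 ∧ d 6 = 1 ∧ d 7 = 0) ∨ (d 4 = 0 ∧ d 5 = 0 ∧ d 6 = 0 ∧ d 7 = 1))) := by
      omega
    rcases h with h | ⟨h0, h1, h2, h3, h | h | h | h⟩ <;>
      simp [Fin.sum_univ_four, *]

lemma eval_zero_of_degree_ne_zero {k : Type*} [CommSemiring k] {φ : MvPolynomial (Fin 8) k} {n : ℕ}
    (hφ : φ.IsWeightedHomogeneous strengthWeight n) (hn : n ≠ 0) : eval 0 φ = 0 := by
  rw [eval_zero, constantCoeff_eq]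
  by_contra h
  exact hn (by simpa using (hφ h).symm)

/-- A function of the coordinates of degree 1 and 2 that vanishes as soon as some linear form
in the coordinates of degree 1 does. -/
def VanishesOnHyperplane {k : Type*} [Field k] (c : (Fin 4 → k) → (Fin 4 → k) → k) : Prop :=
  ∃ l : (Fin 4 → k) →ₗ[k] k, ∀ x z, l x = 0 → c x z = 0

/-- A product of two functions, each the sum of a linear form in the coordinates of degree 2 and
a function of the coordinates of degree 1 vanishing at the origin. -/
def IsProductOfDegreeTwo {k : Type*} [Field k] (c : (Fin 4 → k) → (Fin 4 → k) → k) : Prop :=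
  ∃ (A B : (Fin 4 → k) →ₗ[k] k) (Q R : (Fin 4 → k) → k), Q 0 = 0 ∧ R 0 = 0 ∧
    ∀ x z, c x z = (A z + Q x) * (B z + R x)

lemma component_mul_dichotomy {k : Type*} [Field k] {g h : MvPolynomial (Fin 8) k} {a b : ℕ}
    (ha : 1 ≤ a) (hb : 1 ≤ b) (hg : g.IsWeightedHomogeneous strengthWeight a)
    (hh : h.IsWeightedHomogeneous strengthWeight b) :
    VanishesOnHyperplane (fun x z => eval (weightedPoint x z)
      (weightedHomogeneousComponent strengthWeight 4 (g * h))) ∨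
    IsProductOfDegreeTwo (fun x z => eval (weightedPoint x z)
      (weightedHomogeneousComponent strengthWeight 4 (g * h))) := by
  rw [weightedHomogeneousComponent_of_mem (hg.mul hh)]
  split_ifs with hab
  · obtain rfl | rfl | rfl : a = 1 ∨ a = 2 ∨ b = 1 := by omega
    · obtain ⟨l, hl⟩ := eval_weightedPoint_of_degree_one hg
      exact Or.inl ⟨l, fun x z hx => by simp [hl, hx]⟩
    · obtain rfl : b = 2 := by omega
      obtain ⟨A, hA⟩ := eval_weightedPoint_of_degree_two hg
      obtain ⟨B, hB⟩ := eval_weightedPoint_of_degree_two hh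
      refine Or.inr ⟨A, B, fun x => eval (weightedPoint x 0) g,
        fun x => eval (weightedPoint x 0) h, ?_, ?_, fun x z => ?_⟩
      · simpa [weightedPoint_zero] using eval_zero_of_degree_ne_zero hg two_ne_zero
      · simpa [weightedPoint_zero] using eval_zero_of_degree_ne_zero hh two_ne_zero
      · simp only [map_mul]
        rw [hA, hB]
    · obtain ⟨l, hl⟩ := eval_weightedPoint_of_degree_one hh
      exact Or.inl ⟨l, fun x z hx => by simp [hl, hx]⟩
  · exact Or.inl ⟨0, by simp⟩

lemma four_le_card_of_sum_sq_mul_eq_sum {k ι : Type*} [Field k] [Fintype ι]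
    (c : ι → (Fin 4 → k) → (Fin 4 → k) → k)
    (hc : ∀ i, VanishesOnHyperplane (c i) ∨ IsProductOfDegreeTwo (c i))
    (h : ∀ x z : Fin 4 → k, ∑ i, x i ^ 2 * z i = ∑ i, c i x z) :
    4 ≤ Fintype.card ι := by
  classical
  let P : ι → Prop := fun i => VanishesOnHyperplane (c i)
  choose l hl using fun i : {i // P i} => i.2
  choose A B Q R hQ hR hAB using fun i : {i // ¬ P i} => (hc i).resolve_left i.2
  let L : (Fin 4 → k) →ₗ[k] ({i // P i} → k) := LinearMap.pi l
  let T : (Fin 4 → k) →ₗ[k] ({i // ¬ P i} → k) × ({i // ¬ P i} → k) :=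
    (LinearMap.pi A).prod (LinearMap.pi B)
  have hsplit : ∀ x z, L x = 0 →
      ∑ i, x i ^ 2 * z i = ∑ i, (A i z + Q i x) * (B i z + R i x) := by
    intro x z hx
    rw [h, ← Fintype.sum_subtype_add_sum_subtype P, Finset.sum_eq_zero, zero_add]
    · exact Finset.sum_congr rfl fun i _ => hAB i x z
    · exact fun i _ => hl i x z (congrFun hx i)
  have hT : ∀ z, ∑ i, (T z).1 i * (T z).2 i = 0 := by
    intro z
    simpa [hQ, hR, T] using (hsplit 0 z (map_zero L)).symm
  have h1 := finrank_le_card_add_finrank_ker T hT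
  have h2 := finrank_add_finrank_le_of_sum_sq_mul_eq_zero (LinearMap.ker L) (LinearMap.ker T) <| by
    intro x hx z hz
    have hA : ∀ i, A i z = 0 := fun i => congrFun (congrArg Prod.fst hz) i
    have hB : ∀ i, B i z = 0 := fun i => congrFun (congrArg Prod.snd hz) i
    have hx0 := hsplit x 0 hx
    rw [hsplit x z hx]
    simpa [hA, hB] using hx0.symm
  have h3 := LinearMap.finrank_range_add_finrank_ker L
  have h4 := (LinearMap.range L).finrank_le
  have h5 := Fintype.card_subtype_compl P
  have h6 := Fintype.card_subtype_le P
  simp only [Module.finrank_fintype_fun_eq_card, Fintype.card_fin] at *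
  omega

lemma isWeightedHomogeneous_sq_mul_sum {k : Type*} [CommSemiring k] :
    (X 0 ^ 2 * X 4 + X 1 ^ 2 * X 5 + X 2 ^ 2 * X 6 + X 3 ^ 2 * X 7 :
      MvPolynomial (Fin 8) k).IsWeightedHomogeneous strengthWeight 4 := by
  have hX : ∀ i j : Fin 8, strengthWeight i = 1 → strengthWeight j = 2 →
      (X i ^ 2 * X j : MvPolynomial (Fin 8) k).IsWeightedHomogeneous strengthWeight 4 := by
    intro i j hi hj
    have h := ((isWeightedHomogeneous_X k strengthWeight i).pow 2).mul
      (isWeightedHomogeneous_X k strengthWeight j)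
    rwa [hi, hj] at h
  exact (((hX 0 4 rfl rfl).add (hX 1 5 rfl rfl)).add (hX 2 6 rfl rfl)).add (hX 3 7 rfl rfl)

end

open MvPolynomial in
/-- In `k[x,y,u,v,f,g,p,q]` with `deg x = deg y = deg u = deg v = 1` and
`deg f = deg g = deg p = deg q = 2`, the weighted-homogeneous degree-4 polynomial
`x²f + y²g + u²p + v²q` has strength exactly 4. -/
theorem strength_eq_four (k : Type*) [Field k] :
    WHasStrengthDecompOfLength 4 4
      (X 0 ^ 2 * X 4 + X 1 ^ 2 * X 5 + X 2 ^ 2 * X 6 + X 3 ^ 2 * X 7 :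
        MvPolynomial (Fin 8) k) ∧
    ¬ WHasStrengthDecompOfLength 4 3
      (X 0 ^ 2 * X 4 + X 1 ^ 2 * X 5 + X 2 ^ 2 * X 6 + X 3 ^ 2 * X 7 :
        MvPolynomial (Fin 8) k) := by
  constructor
  · refine ⟨![X 0 ^ 2, X 1 ^ 2, X 2 ^ 2, X 3 ^ 2], ![X 4, X 5, X 6, X 7],
      fun _ => 2, fun _ => 2, fun i => ⟨by norm_num, by norm_num, ?_⟩,
      fun i => ⟨by norm_num, by norm_num, ?_⟩, by simp [Fin.sum_univ_four]⟩
    · fin_cases i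
      exacts [(isWeightedHomogeneous_X k strengthWeight 0).pow 2,
        (isWeightedHomogeneous_X k strengthWeight 1).pow 2,
        (isWeightedHomogeneous_X k strengthWeight 2).pow 2,
        (isWeightedHomogeneous_X k strengthWeight 3).pow 2]
    · fin_cases i
      exacts [isWeightedHomogeneous_X k strengthWeight 4,
        isWeightedHomogeneous_X k strengthWeight 5,
        isWeightedHomogeneous_X k strengthWeight 6,
        isWeightedHomogeneous_X k strengthWeight 7]
  · rintro ⟨g, h, a, b, hg, hh, hF⟩
    have hcard := four_le_card_of_sum_sq_mul_eq_sum (k := k) (ι := Fin 3) _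
      (fun i => component_mul_dichotomy (hg i).1 (hh i).1 (hg i).2.2 (hh i).2.2) fun x z => by
        have hcomp := congrArg (weightedHomogeneousComponent strengthWeight 4) hF
        rw [isWeightedHomogeneous_sq_mul_sum.weightedHomogeneousComponent_same, map_sum] at hcomp
        rw [← map_sum, ← hcomp]
        simp [Fin.sum_univ_four, weightedPoint]
    simp at hcard
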